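/- Let (I', I_∅) be either (I'_DSKS, ⟨G_DSKS, L'_DSKS, ∅⟩) or (I'_DEO, ⟨G_DEO, L'_DEO, ∅⟩). For any finite set E of ground terms in normal form and any ground term t in normal form: E ↠_{I'} E, t (one deduction step modulo the equational theory) if and only if E ↠_{I_∅} E, t (one deduction step modulo the empty theory). -/

import Mathlib

set_option maxHeartbeats 1000000

namespace Paper

/-- First-order terms over a signature `Sg` with arities `ar`, with free
constants (indexed by `ℕ`) and variables (indexed by `ℕ`). -/
inductive Tm (Sg : Type) (ar : Sg → ℕ) : Type where
  | var : ℕ → Tm Sg ar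
  | cst : ℕ → Tm Sg ar
  | app : (s : Sg) → (Fin (ar s) → Tm Sg ar) → Tm Sg ar

variable {Sg : Type} {ar : Sg → ℕ}

/-- Substitutions. -/
abbrev Subst (Sg : Type) (ar : Sg → ℕ) := ℕ → Tm Sg ar

/-- Application of a substitution to a term. -/
def subst (σ : Subst Sg ar) : Tm Sg ar → Tm Sg ar
  | .var n => σ n
  | .cst c => .cst c
  | .app s a => .app s (fun i => subst σ (a i))

/-- Composition of substitutions: `scomp τ σ` first applies `σ`, then `τ`. -/
def scomp (τ σ : Subst Sg ar) : Subst Sg ar := fun n => subst τ (σ n)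

def isVar : Tm Sg ar → Prop
  | .var _ => True
  | _ => False

def isVarB : Tm Sg ar → Bool
  | .var _ => true
  | _ => false

/-- The set of variables of a term. -/
def vars : Tm Sg ar → Set ℕ
  | .var n => {n}
  | .cst _ => ∅
  | .app _ a => ⋃ i, vars (a i)

/-- A term is ground if it has no variables. -/
def Ground (t : Tm Sg ar) : Prop := vars t = ∅

/-- The subterm of `t` at position `p` (a sequence of argument indices). -/
def subtermAt : Tm Sg ar → List ℕ → Option (Tm Sg ar)
  | t, [] => some t
  | .var _, _ :: _ => none
  | .cst _, _ :: _ => none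
  | .app s a, i :: p => if h : i < ar s then subtermAt (a ⟨i, h⟩) p else none

/-- Replacement of the subterm at position `p` by `u`. -/
def replaceAt : Tm Sg ar → List ℕ → Tm Sg ar → Tm Sg ar
  | _, [], u => u
  | .var n, _ :: _, _ => .var n
  | .cst c, _ :: _, _ => .cst c
  | .app s a, i :: p, u => .app s (fun j => if j.1 = i then replaceAt (a j) p u else a j)

/-- The set of subterms of a term. -/
def subterms (t : Tm Sg ar) : Set (Tm Sg ar) := {u | ∃ p, subtermAt t p = some u}

/-- The number of symbols of a term. -/
def tmSize : Tm Sg ar → ℕ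
  | .var _ => 1
  | .cst _ => 1
  | .app _ a => 1 + Finset.univ.sum (fun i => tmSize (a i))

/-- One-step rewriting with the rules `R` (closed under substitution and contexts). -/
inductive Rew (R : Tm Sg ar → Tm Sg ar → Prop) : Tm Sg ar → Tm Sg ar → Prop where
  | root : ∀ (l r : Tm Sg ar) (σ : Subst Sg ar), R l r → Rew R (subst σ l) (subst σ r)
  | congr : ∀ (s : Sg) (a b : Fin (ar s) → Tm Sg ar) (i : Fin (ar s)),
      Rew R (a i) (b i) → (∀ j, j ≠ i → a j = b j) → Rew R (Tm.app s a) (Tm.app s b)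

/-- The reflexive-transitive closure of rewriting. -/
def Reduces (R : Tm Sg ar → Tm Sg ar → Prop) : Tm Sg ar → Tm Sg ar → Prop :=
  Relation.ReflTransGen (Rew R)

/-- A term is in normal form if no rewriting step applies to it. -/
def NormalForm (R : Tm Sg ar → Tm Sg ar → Prop) (t : Tm Sg ar) : Prop := ∀ u, ¬ Rew R t u

/-- A substitution is in normal form if all its images are. -/
def NormalSubst (R : Tm Sg ar → Tm Sg ar → Prop) (σ : Subst Sg ar) : Prop :=
  ∀ n, NormalForm R (σ n)

/-- Termination of rewriting: no infinite rewriting sequences. -/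
def Terminating (R : Tm Sg ar → Tm Sg ar → Prop) : Prop :=
  WellFounded (fun a b : Tm Sg ar => Rew R b a)

/-- Confluence of rewriting. -/
def Confluent (R : Tm Sg ar → Tm Sg ar → Prop) : Prop :=
  ∀ a b c : Tm Sg ar, Reduces R a b → Reduces R a c →
    ∃ d, Reduces R b d ∧ Reduces R c d

/-- Convergence: termination together with confluence. -/
def Convergent (R : Tm Sg ar → Tm Sg ar → Prop) : Prop := Terminating R ∧ Confluent R

/-- The equational theory generated by a set of axioms `A`: the smallest
congruence containing all substitution instances of the axioms. -/
inductive EqTh (A : Tm Sg ar → Tm Sg ar → Prop) : Tm Sg ar → Tm Sg ar → Prop where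
  | ax : ∀ (l r : Tm Sg ar) (σ : Subst Sg ar), A l r → EqTh A (subst σ l) (subst σ r)
  | refl : ∀ t, EqTh A t t
  | symm : ∀ {t u}, EqTh A t u → EqTh A u t
  | trans : ∀ {t u v}, EqTh A t u → EqTh A u v → EqTh A t v
  | congr : ∀ (s : Sg) (a b : Fin (ar s) → Tm Sg ar),
      (∀ i, EqTh A (a i) (b i)) → EqTh A (Tm.app s a) (Tm.app s b)

/-- `σ` unifies `u` and `v` syntactically. -/
def Unifies (σ : Subst Sg ar) (u v : Tm Sg ar) : Prop := subst σ u = subst σ v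

/-- `σ` is a most general (syntactic) unifier of `u` and `v`. -/
def IsMGU (σ : Subst Sg ar) (u v : Tm Sg ar) : Prop :=
  Unifies σ u v ∧ ∀ τ, Unifies τ u v → ∃ ρ, ∀ n, τ n = subst ρ (σ n)

def UnifiesSys (σ : Subst Sg ar) (S : List (Tm Sg ar × Tm Sg ar)) : Prop :=
  ∀ e ∈ S, subst σ e.1 = subst σ e.2

/-- `σ` is a most general (syntactic) unifier of the system `S`. -/
def IsMGUSys (σ : Subst Sg ar) (S : List (Tm Sg ar × Tm Sg ar)) : Prop :=
  UnifiesSys σ S ∧ ∀ τ, UnifiesSys τ S → ∃ ρ, ∀ n, τ n = subst ρ (σ n)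

/-- `σ` is an `H`-unifier (modulo the theory generated by `A`) of the system `S`. -/
def HUnifier (A : Tm Sg ar → Tm Sg ar → Prop) (σ : Subst Sg ar)
    (S : List (Tm Sg ar × Tm Sg ar)) : Prop :=
  ∀ e ∈ S, EqTh A (subst σ e.1) (subst σ e.2)

/-- Narrowing: `t ⤳ t'` with substitution `σ`, using a rule `l → r` of `R` at a
non-variable position `p` of `t`, where `σ = mgu(t|_p, l)`. -/
def Narrow (R : Tm Sg ar → Tm Sg ar → Prop) (t : Tm Sg ar) (σ : Subst Sg ar)
    (t' : Tm Sg ar) : Prop :=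
  ∃ l r p u, R l r ∧ subtermAt t p = some u ∧ ¬ isVar u ∧ IsMGU σ u l ∧
    t' = replaceAt (subst σ t) p (subst σ r)

/-- The non-variable positions of a term. -/
def nonVarPos (t : Tm Sg ar) : Set (List ℕ) :=
  {p | ∃ u, subtermAt t p = some u ∧ ¬ isVar u}

/-- A configuration for basic narrowing: a term with its set of basic positions. -/
abbrev Conf (Sg : Type) (ar : Sg → ℕ) := Tm Sg ar × Set (List ℕ)

/-- One basic narrowing step: narrowing at a basic position; the basic positions
of the result are those of the source not below the redex position `p`,
together with `p·q` for `q` a non-variable position of the right-hand side. -/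
def BNStep (R : Tm Sg ar → Tm Sg ar → Prop) (c : Conf Sg ar) (σ : Subst Sg ar)
    (c' : Conf Sg ar) : Prop :=
  ∃ l r p u, R l r ∧ p ∈ c.2 ∧ subtermAt c.1 p = some u ∧ ¬ isVar u ∧ IsMGU σ u l ∧
    c'.1 = replaceAt (subst σ c.1) p (subst σ r) ∧
    c'.2 = {q | q ∈ c.2 ∧ ¬ (p <+: q)} ∪ {q | ∃ q', q = p ++ q' ∧ q' ∈ nonVarPos r}

/-- Sequences of basic narrowing steps, recording the composed substitution. -/
inductive BN (R : Tm Sg ar → Tm Sg ar → Prop) : Conf Sg ar → Subst Sg ar → Conf Sg ar → Prop where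
  | refl : ∀ c, BN R c Tm.var c
  | step : ∀ {c c' c'' : Conf Sg ar} {σ θ : Subst Sg ar},
      BNStep R c σ c' → BN R c' θ c'' → BN R c (scomp θ σ) c''

/-- Basic narrowing between terms, starting with all non-variable positions basic. -/
def BNTerms (R : Tm Sg ar → Tm Sg ar → Prop) (t : Tm Sg ar) (σ : Subst Sg ar)
    (t' : Tm Sg ar) : Prop :=
  ∃ B, BN R (t, nonVarPos t) σ (t', B)

/-! ### Intruder deduction systems -/

/-- An intruder deduction rule `l ↠ r`: a set of premises and a conclusion. -/
abbrev Rule (Sg : Type) (ar : Sg → ℕ) := Set (Tm Sg ar) × Tm Sg ar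

/-- One deduction step modulo the equational theory generated by `A`. -/
def DedStep (L : Set (Rule Sg ar)) (A : Tm Sg ar → Tm Sg ar → Prop)
    (E F : Set (Tm Sg ar)) : Prop :=
  ∃ l r σ r', (l, r) ∈ L ∧ (∀ u ∈ l, ∃ u' ∈ E, EqTh A (subst σ u) u') ∧
    EqTh A (subst σ r) r' ∧ F = E ∪ {r'}

/-- `t` is derivable from `E` modulo `A`. -/
def Deriv (L : Set (Rule Sg ar)) (A : Tm Sg ar → Tm Sg ar → Prop)
    (E : Set (Tm Sg ar)) (t : Tm Sg ar) : Prop :=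
  ∃ F, Relation.ReflTransGen (DedStep L A) E F ∧ t ∈ F

/-- One deduction step modulo the empty equational theory. -/
def DedStepSyn (L : Set (Rule Sg ar)) (E F : Set (Tm Sg ar)) : Prop :=
  ∃ l r σ, (l, r) ∈ L ∧ (∀ u ∈ l, subst σ u ∈ E) ∧ F = E ∪ {subst σ r}

/-- `t` is derivable from `E` modulo the empty theory. -/
def DerivSyn (L : Set (Rule Sg ar)) (E : Set (Tm Sg ar)) (t : Tm Sg ar) : Prop :=
  ∃ F, Relation.ReflTransGen (DedStepSyn L) E F ∧ t ∈ F

/-! ### Constraint systems -/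

/-- A constraint system with variable right-hand sides: a sequence of pairs
`(E_i, v_i)` of a finite knowledge set and a variable. -/
abbrev CSys (Sg : Type) (ar : Sg → ℕ) := List (List (Tm Sg ar) × ℕ)

/-- A general (extended) constraint system: deduction constraints `E_i ▷ t_i`. -/
abbrev GCS (Sg : Type) (ar : Sg → ℕ) := List (List (Tm Sg ar) × Tm Sg ar)

/-- The set of instances by `σ` of the members of `E`. -/
def substList (σ : Subst Sg ar) (E : List (Tm Sg ar)) : Set (Tm Sg ar) :=
  {u | ∃ e ∈ E, u = subst σ e}

/-- Well-formedness of a constraint system `((E_i ▷ v_i))_i`: knowledge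
monotonicity and origination of variables. -/
def WFC (C : CSys Sg ar) : Prop :=
  (∀ i j (hi : i < C.length) (hj : j < C.length), i ≤ j →
     ∀ u ∈ (C.get ⟨i, hi⟩).1, u ∈ (C.get ⟨j, hj⟩).1) ∧
  (∀ i (hi : i < C.length), ∀ u ∈ (C.get ⟨i, hi⟩).1, ∀ x ∈ vars u,
     ∃ j, ∃ hj : j < C.length, j < i ∧ (C.get ⟨j, hj⟩).2 = x)

/-- Well-formedness of a general constraint system `((E_i ▷ t_i))_i`. -/
def WFG (C : GCS Sg ar) : Prop :=
  (∀ i j (hi : i < C.length) (hj : j < C.length), i ≤ j →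
     ∀ u ∈ (C.get ⟨i, hi⟩).1, u ∈ (C.get ⟨j, hj⟩).1) ∧
  (∀ i (hi : i < C.length), ∀ u ∈ (C.get ⟨i, hi⟩).1, ∀ x ∈ vars u,
     ∃ j, ∃ hj : j < C.length, j < i ∧ (C.get ⟨j, hj⟩).2 = Tm.var x)

/-- `σ` satisfies the constraint system `(C, S)` in the intruder system given by
deduction rules `L` modulo the theory generated by `A`. -/
def SatC (L : Set (Rule Sg ar)) (A : Tm Sg ar → Tm Sg ar → Prop)
    (σ : Subst Sg ar) (C : CSys Sg ar) (S : List (Tm Sg ar × Tm Sg ar)) : Prop :=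
  (∀ p ∈ C, Deriv L A (substList σ p.1) (σ p.2)) ∧ HUnifier A σ S

/-- `σ` satisfies the deduction constraints of `C` modulo `A`. -/
def SatG (L : Set (Rule Sg ar)) (A : Tm Sg ar → Tm Sg ar → Prop)
    (σ : Subst Sg ar) (C : GCS Sg ar) : Prop :=
  ∀ p ∈ C, Deriv L A (substList σ p.1) (subst σ p.2)

/-- `σ` satisfies the deduction constraints of `C` modulo the empty theory. -/
def SatGSyn (L : Set (Rule Sg ar)) (σ : Subst Sg ar) (C : GCS Sg ar) : Prop :=
  ∀ p ∈ C, DerivSyn L (substList σ p.1) (subst σ p.2)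

/-- A general constraint system is in solved form when every right-hand side is
a variable. -/
def SolvedForm (C : GCS Sg ar) : Prop := ∀ p ∈ C, isVar p.2

/-- Viewing a constraint system with variable right-hand sides as a general one. -/
def toGCS (C : CSys Sg ar) : GCS Sg ar := C.map (fun p => (p.1, Tm.var p.2))

/-- Componentwise basic narrowing of lists of terms. -/
def ListNarrow (R : Tm Sg ar → Tm Sg ar → Prop) (E E' : List (Tm Sg ar)) : Prop :=
  E.length = E'.length ∧
  ∀ i (h : i < E.length) (h' : i < E'.length),
    ∃ μ, BNTerms R (E.get ⟨i, h⟩) μ (E'.get ⟨i, h'⟩)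

/-- `C'` is obtained from `C` by applying basic narrowing steps to the
subterms of `C`. -/
def CNarrow (R : Tm Sg ar → Tm Sg ar → Prop) (C C' : GCS Sg ar) : Prop :=
  C.length = C'.length ∧
  ∀ i (h : i < C.length) (h' : i < C'.length),
    ListNarrow R (C.get ⟨i, h⟩).1 (C'.get ⟨i, h'⟩).1 ∧
    ∃ μ, BNTerms R (C.get ⟨i, h⟩).2 μ (C'.get ⟨i, h'⟩).2

/-! ### Saturation -/

/-- Rule `ρ` is subsumed by a rule of `L`. -/
def Subsumed (L : Set (Rule Sg ar)) (ρ : Rule Sg ar) : Prop :=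
  ∃ l1, (l1, ρ.2) ∈ L ∧ l1 ⊆ ρ.1

/-- One narrowing step on a deduction rule `(l, r)`, performed on the
conclusion or on one of the premises, instantiating the rest. -/
def RuleNarrow (R : Tm Sg ar → Tm Sg ar → Prop) (ρ ρ' : Rule Sg ar) : Prop :=
  (∃ σ r', Narrow R ρ.2 σ r' ∧ ρ' = ((subst σ) '' ρ.1, r')) ∨
  (∃ u ∈ ρ.1, ∃ σ u', Narrow R u σ u' ∧
      ρ' = (insert u' ((subst σ) '' (ρ.1 \ {u})), subst σ ρ.2))

/-- The saturation rules of Figure 1: Subsumption, Closure and Narrow. -/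
inductive SatStep (R : Tm Sg ar → Tm Sg ar → Prop) :
    Set (Rule Sg ar) → Set (Rule Sg ar) → Prop where
  | subsum : ∀ {L : Set (Rule Sg ar)} {l1 l2 : Set (Tm Sg ar)} {r : Tm Sg ar},
      (l1, r) ∈ L → (l2, r) ∈ L → l1 ⊆ l2 → l1 ≠ l2 → SatStep R L (L \ {(l2, r)})
  | closure : ∀ {L : Set (Rule Sg ar)} {l1 l2 : Set (Tm Sg ar)}
      {r1 t r2 : Tm Sg ar} {σ : Subst Sg ar},
      (l1, r1) ∈ L → (insert t l2, r2) ∈ L → ¬ isVar t → IsMGU σ r1 t →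
      SatStep R L (insert ((subst σ) '' (l1 ∪ l2), subst σ r2) L)
  | narrow : ∀ {L : Set (Rule Sg ar)} {ρ ρ' : Rule Sg ar},
      ρ ∈ L → RuleNarrow R ρ ρ' → SatStep R L (insert ρ' L)

/-- `L` is saturated: every rule produced by Closure or Narrow is subsumed. -/
def Saturated (R : Tm Sg ar → Tm Sg ar → Prop) (L : Set (Rule Sg ar)) : Prop :=
  (∀ (l1 l2 : Set (Tm Sg ar)) (r1 t r2 : Tm Sg ar) (σ : Subst Sg ar),
     (l1, r1) ∈ L → (insert t l2, r2) ∈ L → ¬ isVar t → IsMGU σ r1 t →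
     Subsumed L ((subst σ) '' (l1 ∪ l2), subst σ r2)) ∧
  (∀ ρ ∈ L, ∀ ρ', RuleNarrow R ρ ρ' → Subsumed L ρ')

/-! ### Transformation rules on constraint systems (Figure 2) -/

/-- Instantiation of a constraint system. -/
def csubst (σ : Subst Sg ar) (C : GCS Sg ar) : GCS Sg ar :=
  C.map (fun p => (p.1.map (subst σ), subst σ p.2))

/-- The transformation rules `Unif` and `Apply` of Figure 2, applied to the
first deduction constraint whose right-hand side is not a variable. -/
inductive TStep (L' : Set (Rule Sg ar)) : GCS Sg ar → GCS Sg ar → Prop where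
  | unif : ∀ {Cα Cβ : GCS Sg ar} {E : List (Tm Sg ar)} {t u : Tm Sg ar} {σ : Subst Sg ar},
      SolvedForm Cα → ¬ isVar t → u ∈ E → ¬ isVar u → IsMGU σ u t →
      TStep L' (Cα ++ (E, t) :: Cβ) (csubst σ (Cα ++ Cβ))
  | apply : ∀ {Cα Cβ : GCS Sg ar} {E : List (Tm Sg ar)} {t r : Tm Sg ar}
      {l : Set (Tm Sg ar)} {lx lnl el : List (Tm Sg ar)} {σ : Subst Sg ar},
      SolvedForm Cα → ¬ isVar t → (l, r) ∈ L' →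
      (∀ u ∈ lx, isVar u) → (∀ u, u ∈ l ↔ (u ∈ lx ∨ u ∈ lnl)) →
      el.length = lnl.length → (∀ e ∈ el, e ∈ E) →
      IsMGUSys σ ((el.zip lnl) ++ [(r, t)]) →
      TStep L' (Cα ++ (E, t) :: Cβ)
        (csubst σ (Cα ++ (lx.map (fun y => (E, y))) ++ Cβ))

/-! ### Narrowing of unification systems (for Hullot's procedure) -/

/-- An equation between two basic-narrowing configurations. -/
abbrev EqConf (Sg : Type) (ar : Sg → ℕ) := Conf Sg ar × Conf Sg ar

def csub (σ : Subst Sg ar) (e : EqConf Sg ar) : EqConf Sg ar :=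
  ((subst σ e.1.1, e.1.2), (subst σ e.2.1, e.2.2))

/-- One basic narrowing step on one side of one equation of the system, the
substitution being applied to the whole system. -/
def SysBNStep (R : Tm Sg ar → Tm Sg ar → Prop) (c : List (EqConf Sg ar))
    (σ : Subst Sg ar) (c' : List (EqConf Sg ar)) : Prop :=
  ∃ (i : Fin c.length) (side : Bool) (d : Conf Sg ar),
    BNStep R (if side then (c.get i).1 else (c.get i).2) σ d ∧
    c' = (c.map (csub σ)).set i.1
      (if side then (d, (csub σ (c.get i)).2) else ((csub σ (c.get i)).1, d))

/-- Sequences of basic narrowing steps on a unification system, recording the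
composed substitution. -/
inductive SysBN (R : Tm Sg ar → Tm Sg ar → Prop) :
    List (EqConf Sg ar) → Subst Sg ar → List (EqConf Sg ar) → Prop where
  | refl : ∀ c, SysBN R c Tm.var c
  | step : ∀ {c c' c'' : List (EqConf Sg ar)} {σ θ : Subst Sg ar},
      SysBNStep R c σ c' → SysBN R c' θ c'' → SysBN R c (scomp θ σ) c''

/-- The initial configuration of a unification system: all non-variable
positions are basic. -/
def initConf (S : List (Tm Sg ar × Tm Sg ar)) : List (EqConf Sg ar) :=
  S.map (fun e => ((e.1, nonVarPos e.1), (e.2, nonVarPos e.2)))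

/-- The substitutions output by Hullot's procedure on the system `S`: a basic
narrowing derivation followed by syntactic unification of the resulting system. -/
def ProcOutput (R : Tm Sg ar → Tm Sg ar → Prop) (S : List (Tm Sg ar × Tm Sg ar))
    (δ : Subst Sg ar) : Prop :=
  ∃ c' σ τ, SysBN R (initConf S) σ c' ∧
    IsMGUSys τ (c'.map (fun e => (e.1.1, e.2.1))) ∧ δ = scomp τ σ

/-- The size of a unification system. -/
def sysSize (S : List (Tm Sg ar × Tm Sg ar)) : ℕ :=
  (S.map (fun e => tmSize e.1 + tmSize e.2)).sum

/-- The size of a certificate (a substitution presented as a finite list). -/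
def certSize (c : List (ℕ × Tm Sg ar)) : ℕ := (c.map (fun e => tmSize e.2)).sum

/-! ### The DSKS signature -/

/-- The signature G_DSKS = {Sig, Ver, SK', PK', 0, 1, SK, PK}. -/
inductive SgD : Type | sig | ver | skp | pkp | zero | one | sk | pk

def arD : SgD → ℕ
  | .sig => 2 | .ver => 3 | .skp => 2 | .pkp => 2
  | .zero => 0 | .one => 0 | .sk => 1 | .pk => 1

abbrev TmD := Tm SgD arD

def dSig (a b : TmD) : TmD := .app .sig ![a, b]
def dVer (a b c : TmD) : TmD := .app .ver ![a, b, c]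
def dSkp (a b : TmD) : TmD := .app .skp ![a, b]
def dPkp (a b : TmD) : TmD := .app .pkp ![a, b]
def dSk (a : TmD) : TmD := .app .sk ![a]
def dPk (a : TmD) : TmD := .app .pk ![a]
def dZero : TmD := .app .zero ![]
def dOne : TmD := .app .one ![]

def xD : TmD := .var 0
def yD : TmD := .var 1
def zD : TmD := .var 2
def y1D : TmD := .var 1
def y2D : TmD := .var 2

/-- The convergent rewrite system R_DSKS. -/
inductive RDSKS : TmD → TmD → Prop where
  | r1 : RDSKS (dVer xD (dSig xD (dSk yD)) (dPk yD)) dOne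
  | r2 : RDSKS (dVer xD (dSig xD (dSkp y1D y2D)) (dPkp y1D y2D)) dOne
  | r3 : RDSKS (dVer xD (dSig xD (dSk yD)) (dPkp (dPk yD) (dSig xD (dSk yD)))) dOne
  | r4 : RDSKS (dSig xD (dSkp (dPk yD) (dSig xD (dSk yD)))) (dSig xD (dSk yD))

/-- The axioms A_DSKS presenting the equational theory H_DSKS. -/
inductive ADSKS : TmD → TmD → Prop where
  | a1 : ADSKS (dVer xD (dSig xD (dSk yD)) (dPk yD)) dOne
  | a2 : ADSKS (dVer xD (dSig xD (dSkp y1D y2D)) (dPkp y1D y2D)) dOne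
  | a3 : ADSKS (dSig xD (dSkp (dPk yD) (dSig xD (dSk yD)))) (dSig xD (dSk yD))

/-- The intruder deduction rules L_DSKS. -/
def LDSKS : Set (Rule SgD arD) :=
  { (({xD, yD} : Set TmD), dSig xD yD), (({xD, yD, zD} : Set TmD), dVer xD yD zD),
    (({xD, yD} : Set TmD), dSkp xD yD), (({xD, yD} : Set TmD), dPkp xD yD),
    ((∅ : Set TmD), dZero), ((∅ : Set TmD), dOne) }

/-- The saturated deduction rules L'_DSKS. -/
def LDSKS' : Set (Rule SgD arD) :=
  LDSKS ∪ { (({xD, dSk yD} : Set TmD), dSig xD (dSk yD)),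
            (({xD, dSkp (dPk yD) (dSig xD (dSk yD))} : Set TmD), dSig xD (dSk yD)) }

/-! ### The DEO signature -/

/-- The signature G_DEO = {Sig, Ver, SK'', PK'', f, 0, 1, SK, PK}. -/
inductive SgE : Type | sig | ver | skp | pkp | f | zero | one | sk | pk

def arE : SgE → ℕ
  | .sig => 2 | .ver => 3 | .skp => 2 | .pkp => 2 | .f => 2
  | .zero => 0 | .one => 0 | .sk => 1 | .pk => 1

abbrev TmE := Tm SgE arE

def eSig (a b : TmE) : TmE := .app .sig ![a, b]
def eVer (a b c : TmE) : TmE := .app .ver ![a, b, c]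
def eSkp (a b : TmE) : TmE := .app .skp ![a, b]
def ePkp (a b : TmE) : TmE := .app .pkp ![a, b]
def eF (a b : TmE) : TmE := .app .f ![a, b]
def eSk (a : TmE) : TmE := .app .sk ![a]
def ePk (a : TmE) : TmE := .app .pk ![a]
def eZero : TmE := .app .zero ![]
def eOne : TmE := .app .one ![]

def xE : TmE := .var 0
def yE : TmE := .var 1
def zE : TmE := .var 2
def y1E : TmE := .var 1
def y2E : TmE := .var 2

/-- The convergent rewrite system R_DEO. -/
inductive RDEO : TmE → TmE → Prop where
  | r1 : RDEO (eVer xE (eSig xE (eSk yE)) (ePk yE)) eOne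
  | r2 : RDEO (eVer xE (eSig xE (eSkp y1E y2E)) (ePkp y1E y2E)) eOne
  | r3 : RDEO (eVer (eF (ePk yE) (eSig xE (eSk yE))) (eSig xE (eSk yE))
      (ePkp (ePk yE) (eSig xE (eSk yE)))) eOne
  | r4 : RDEO (eSig (eF (ePk yE) (eSig xE (eSk yE))) (eSkp (ePk yE) (eSig xE (eSk yE))))
      (eSig xE (eSk yE))

/-- The axioms A_DEO presenting the equational theory H_DEO. -/
inductive ADEO : TmE → TmE → Prop where
  | a1 : ADEO (eVer xE (eSig xE (eSk yE)) (ePk yE)) eOne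
  | a2 : ADEO (eVer xE (eSig xE (eSkp y1E y2E)) (ePkp y1E y2E)) eOne
  | a3 : ADEO (eSig (eF (ePk yE) (eSig xE (eSk yE))) (eSkp (ePk yE) (eSig xE (eSk yE))))
      (eSig xE (eSk yE))

/-- The intruder deduction rules L_DEO. -/
def LDEO : Set (Rule SgE arE) :=
  { (({xE, yE} : Set TmE), eSig xE yE), (({xE, yE, zE} : Set TmE), eVer xE yE zE),
    (({xE, yE} : Set TmE), eSkp xE yE), (({xE, yE} : Set TmE), ePkp xE yE),
    (({xE, yE} : Set TmE), eF xE yE),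
    ((∅ : Set TmE), eZero), ((∅ : Set TmE), eOne) }

/-- The saturated deduction rules L'_DEO. -/
def LDEO' : Set (Rule SgE arE) :=
  LDEO ∪ { (({eF (ePk yE) (eSig xE (eSk yE)), eSkp (ePk yE) (eSig xE (eSk yE))} : Set TmE),
            eSig xE (eSk yE)) }


end Paper

namespace Paper

section RootNormalization

variable {Sg : Type} {ar : Sg → ℕ}

theorem Tm.app_injective {s : Sg} {a b : Fin (ar s) → Tm Sg ar}
    (h : Tm.app s a = Tm.app s b) : a = b := by
  cases h; rfl

theorem Tm.app_ne_app {s s' : Sg} (hs : s ≠ s') (a : Fin (ar s) → Tm Sg ar)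
    (b : Fin (ar s') → Tm Sg ar) : Tm.app s a ≠ Tm.app s' b := by
  intro h; cases h; exact hs rfl

/-- No term has two different contracta at its root. -/
def RootDeterministic (R : Tm Sg ar → Tm Sg ar → Prop) : Prop :=
  ∀ l r l' r' σ σ', R l r → R l' r' → subst σ l = subst σ' l' → subst σ r = subst σ' r'

open Classical in
/-- Contract the root of `t` once if some rule applies there. -/
noncomputable def contractRoot (R : Tm Sg ar → Tm Sg ar → Prop) (t : Tm Sg ar) : Tm Sg ar :=
  if h : ∃ u l r σ, R l r ∧ t = subst σ l ∧ u = subst σ r then h.choose else t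

theorem contractRoot_cases (R : Tm Sg ar → Tm Sg ar → Prop) (t : Tm Sg ar) :
    contractRoot R t = t ∨
      ∃ l r σ, R l r ∧ t = subst σ l ∧ contractRoot R t = subst σ r := by
  unfold contractRoot
  split_ifs with h
  · exact Or.inr h.choose_spec
  · exact Or.inl rfl

theorem contractRoot_of_rule {R : Tm Sg ar → Tm Sg ar → Prop} (hR : RootDeterministic R)
    {l r : Tm Sg ar} (σ : Subst Sg ar) (h : R l r) :
    contractRoot R (subst σ l) = subst σ r := by
  have hex : ∃ u l' r' σ', R l' r' ∧ subst σ l = subst σ' l' ∧ u = subst σ' r' :=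
    ⟨_, l, r, σ, h, rfl, rfl⟩
  unfold contractRoot
  rw [dif_pos hex]
  obtain ⟨l', r', σ', h', he, hu⟩ := hex.choose_spec
  rw [hu]
  exact (hR _ _ _ _ _ _ h h' he).symm

/-- Bottom-up contraction, once at every position. -/
noncomputable def contract (R : Tm Sg ar → Tm Sg ar → Prop) : Tm Sg ar → Tm Sg ar
  | .var n => .var n
  | .cst c => .cst c
  | .app s a => contractRoot R (.app s (fun i => contract R (a i)))

theorem contract_eq_self_of_normalForm {R : Tm Sg ar → Tm Sg ar → Prop} {t : Tm Sg ar}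
    (ht : NormalForm R t) : contract R t = t := by
  induction t with
  | var n => rfl
  | cst c => rfl
  | app s a ih =>
    have ha : (fun i => contract R (a i)) = a := by
      funext i
      refine ih i fun u hu => ?_
      refine ht (.app s (Function.update a i u)) (Rew.congr s a _ i ?_ ?_)
      · simpa using hu
      · intro j hj
        simp [hj]
    rw [contract, ha]
    rcases contractRoot_cases R (.app s a) with h | ⟨l, r, σ, hlr, hl, -⟩
    · exact h
    · exact absurd (hl ▸ Rew.root l r σ hlr) (ht _)

theorem contract_eq_of_eqTh {R A : Tm Sg ar → Tm Sg ar → Prop}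
    (hA : ∀ l r σ, A l r → contract R (subst σ l) = contract R (subst σ r))
    {t u : Tm Sg ar} (h : EqTh A t u) : contract R t = contract R u := by
  induction h with
  | ax l r σ h => exact hA l r σ h
  | refl t => rfl
  | symm _ ih => exact ih.symm
  | trans _ _ ih₁ ih₂ => exact ih₁.trans ih₂
  | congr s a b _ ih => simp only [contract, ih]

theorem DedStepSyn.dedStep {L : Set (Rule Sg ar)} (A : Tm Sg ar → Tm Sg ar → Prop)
    {E F : Set (Tm Sg ar)} (h : DedStepSyn L E F) : DedStep L A E F := by
  obtain ⟨l, r, σ, hL, hl, hF⟩ := h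
  exact ⟨l, r, σ, _, hL, fun u hu => ⟨_, hl u hu, .refl _⟩, .refl _, hF⟩

/-- A deduction step modulo `A` between sets of normal forms, expressed through `contract`. -/
theorem DedStep.exists_contract {R A : Tm Sg ar → Tm Sg ar → Prop} {L : Set (Rule Sg ar)}
    (hA : ∀ l r σ, A l r → contract R (subst σ l) = contract R (subst σ r))
    {E : Set (Tm Sg ar)} {t : Tm Sg ar} (hE : ∀ u ∈ E, NormalForm R u) (ht : NormalForm R t)
    (h : DedStep L A E (E ∪ {t})) :
    ∃ l r σ, (l, r) ∈ L ∧ (∀ u ∈ l, contract R (subst σ u) ∈ E) ∧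
      E ∪ {t} = E ∪ {contract R (subst σ r)} := by
  obtain ⟨l, r, σ, r', hL, hl, hr, hF⟩ := h
  refine ⟨l, r, σ, hL, fun u hu => ?_, ?_⟩
  · obtain ⟨u', hu', he⟩ := hl u hu
    rwa [contract_eq_of_eqTh hA he, contract_eq_self_of_normalForm (hE u' hu')]
  · have hmem : r' ∈ E ∪ {t} := by rw [hF]; simp
    have hr' : NormalForm R r' := by
      rcases hmem with h | h
      · exact hE _ h
      · rw [Set.mem_singleton_iff.1 h]; exact ht
    rwa [contract_eq_of_eqTh hA hr, contract_eq_self_of_normalForm hr']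

end RootNormalization

section DSKS

variable (σ : Subst SgD arD) (a b c a' b' c' : TmD)

theorem subst_dSig : subst σ (dSig a b) = dSig (subst σ a) (subst σ b) := by
  simp only [dSig, subst]; congr 1; funext i; fin_cases i <;> rfl
theorem subst_dVer : subst σ (dVer a b c) = dVer (subst σ a) (subst σ b) (subst σ c) := by
  simp only [dVer, subst]; congr 1; funext i; fin_cases i <;> rfl
theorem subst_dSkp : subst σ (dSkp a b) = dSkp (subst σ a) (subst σ b) := by
  simp only [dSkp, subst]; congr 1; funext i; fin_cases i <;> rfl
theorem subst_dPkp : subst σ (dPkp a b) = dPkp (subst σ a) (subst σ b) := by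
  simp only [dPkp, subst]; congr 1; funext i; fin_cases i <;> rfl
theorem subst_dSk : subst σ (dSk a) = dSk (subst σ a) := by
  simp only [dSk, subst]; congr 1; funext i; fin_cases i; rfl
theorem subst_dPk : subst σ (dPk a) = dPk (subst σ a) := by
  simp only [dPk, subst]; congr 1; funext i; fin_cases i; rfl
theorem subst_dZero : subst σ dZero = dZero := by
  simp only [dZero, subst]; congr 1; funext i; exact i.elim0
theorem subst_dOne : subst σ dOne = dOne := by
  simp only [dOne, subst]; congr 1; funext i; exact i.elim0

theorem dSig_inj : dSig a b = dSig a' b' ↔ a = a' ∧ b = b' :=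
  ⟨fun h => ⟨congrFun (Tm.app_injective h) (0 : Fin 2),
    congrFun (Tm.app_injective h) (1 : Fin 2)⟩,
    by rintro ⟨rfl, rfl⟩; rfl⟩
theorem dVer_inj : dVer a b c = dVer a' b' c' ↔ a = a' ∧ b = b' ∧ c = c' :=
  ⟨fun h => ⟨congrFun (Tm.app_injective h) (0 : Fin 3),
    congrFun (Tm.app_injective h) (1 : Fin 3),
    congrFun (Tm.app_injective h) (2 : Fin 3)⟩,
    by rintro ⟨rfl, rfl, rfl⟩; rfl⟩
theorem dSkp_inj : dSkp a b = dSkp a' b' ↔ a = a' ∧ b = b' :=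
  ⟨fun h => ⟨congrFun (Tm.app_injective h) (0 : Fin 2),
    congrFun (Tm.app_injective h) (1 : Fin 2)⟩,
    by rintro ⟨rfl, rfl⟩; rfl⟩
theorem dPk_inj : dPk a = dPk a' ↔ a = a' :=
  ⟨fun h => congrFun (Tm.app_injective h) (0 : Fin 1),
    by rintro rfl; rfl⟩

theorem dSk_ne_dSkp : dSk a ≠ dSkp a' b' :=
  Tm.app_ne_app (by simp) _ _
theorem dVer_ne_dSig : dVer a b c ≠ dSig a' b' :=
  Tm.app_ne_app (by simp) _ _

/-- Shape of the redexes of `RDSKS`. -/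
theorem RDSKS.redex_cases {l r : TmD} (h : RDSKS l r) :
    ((∃ a b c, subst σ l = dVer a b c) ∧ subst σ r = dOne) ∨
      subst σ l = dSig (σ 0) (dSkp (dPk (σ 1)) (dSig (σ 0) (dSk (σ 1)))) ∧
        subst σ r = dSig (σ 0) (dSk (σ 1)) := by
  cases h <;>
    simp [subst_dVer, subst_dSig, subst_dSk, subst_dSkp, subst_dPk, subst_dPkp, subst_dOne,
      dVer_inj, xD, yD, subst]

theorem RDSKS.rootDeterministic : RootDeterministic RDSKS := by
  intro l r l' r' σ σ' h h' he
  rcases h.redex_cases σ with ⟨⟨a, b, c, h₁⟩, h₂⟩ | ⟨h₁, h₂⟩ <;>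
    rcases h'.redex_cases σ' with ⟨⟨a', b', c', h₁'⟩, h₂'⟩ | ⟨h₁', h₂'⟩ <;>
    rw [h₁, h₁'] at he <;> rw [h₂, h₂']
  · exact (dVer_ne_dSig _ _ _ _ _ he).elim
  · exact (dVer_ne_dSig _ _ _ _ _ he.symm).elim
  · simp only [dSig_inj, dSkp_inj, dPk_inj] at he
    rw [he.1, he.2.1]

theorem contractRoot_RDSKS_eq_self {t : TmD} (hv : ∀ a b c, t ≠ dVer a b c)
    (hs : ∀ a b, t ≠ dSig a (dSkp (dPk b) (dSig a (dSk b)))) : contractRoot RDSKS t = t := by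
  rcases contractRoot_cases RDSKS t with h | ⟨l, r, σ, h, ht, -⟩
  · exact h
  · rcases h.redex_cases σ with ⟨⟨a, b, c, h₁⟩, -⟩ | ⟨h₁, -⟩
    · exact absurd (ht.trans h₁) (hv _ _ _)
    · exact absurd (ht.trans h₁) (hs _ _)

theorem contract_dVer : contract RDSKS (dVer a b c) =
    contractRoot RDSKS (dVer (contract RDSKS a) (contract RDSKS b) (contract RDSKS c)) := by
  simp only [dVer, contract]; congr 2; funext i; fin_cases i <;> rfl
theorem contract_dSig : contract RDSKS (dSig a b) =
    contractRoot RDSKS (dSig (contract RDSKS a) (contract RDSKS b)) := by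
  simp only [dSig, contract]; congr 2; funext i; fin_cases i <;> rfl
theorem contract_dSkp :
    contract RDSKS (dSkp a b) = dSkp (contract RDSKS a) (contract RDSKS b) := by
  refine Eq.trans ?_ (contractRoot_RDSKS_eq_self (t := dSkp (contract RDSKS a) _) ?_ ?_)
  · simp only [dSkp, contract]; congr 2; funext i; fin_cases i <;> rfl
  all_goals intros; exact Tm.app_ne_app (by simp) _ _
theorem contract_dPkp :
    contract RDSKS (dPkp a b) = dPkp (contract RDSKS a) (contract RDSKS b) := by
  refine Eq.trans ?_ (contractRoot_RDSKS_eq_self (t := dPkp (contract RDSKS a) _) ?_ ?_)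
  · simp only [dPkp, contract]; congr 2; funext i; fin_cases i <;> rfl
  all_goals intros; exact Tm.app_ne_app (by simp) _ _
theorem contract_dSk : contract RDSKS (dSk a) = dSk (contract RDSKS a) := by
  refine Eq.trans ?_ (contractRoot_RDSKS_eq_self (t := dSk (contract RDSKS a)) ?_ ?_)
  · simp only [dSk, contract]; congr 2; funext i; fin_cases i; rfl
  all_goals intros; exact Tm.app_ne_app (by simp) _ _
theorem contract_dPk : contract RDSKS (dPk a) = dPk (contract RDSKS a) := by
  refine Eq.trans ?_ (contractRoot_RDSKS_eq_self (t := dPk (contract RDSKS a)) ?_ ?_)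
  · simp only [dPk, contract]; congr 2; funext i; fin_cases i; rfl
  all_goals intros; exact Tm.app_ne_app (by simp) _ _
theorem contract_dZero : contract RDSKS dZero = dZero := by
  refine Eq.trans ?_ (contractRoot_RDSKS_eq_self (t := dZero) ?_ ?_)
  · simp only [dZero, contract]; congr 2; funext i; exact i.elim0
  all_goals intros; exact Tm.app_ne_app (by simp) _ _
theorem contract_dOne : contract RDSKS dOne = dOne := by
  refine Eq.trans ?_ (contractRoot_RDSKS_eq_self (t := dOne) ?_ ?_)
  · simp only [dOne, contract]; congr 2; funext i; exact i.elim0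
  all_goals intros; exact Tm.app_ne_app (by simp) _ _

theorem contractRoot_dSig_dSk :
    contractRoot RDSKS (dSig a (dSk b)) = dSig a (dSk b) := by
  apply contractRoot_RDSKS_eq_self
  · intros; exact Tm.app_ne_app (by simp) _ _
  · intro a' b' h
    exact dSk_ne_dSkp _ _ _ ((dSig_inj ..).1 h).2

theorem contractRoot_dSig_dSkp :
    contractRoot RDSKS (dSig a (dSkp (dPk b) (dSig a (dSk b)))) = dSig a (dSk b) := by
  simpa [subst_dSig, subst_dSkp, subst_dPk, subst_dSk, subst, xD, yD] using
    contractRoot_of_rule RDSKS.rootDeterministic (fun n => if n = 0 then a else b) RDSKS.r4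

theorem contractRoot_dSig_cases :
    contractRoot RDSKS (dSig a b) = dSig a b ∨
      ∃ y, b = dSkp (dPk y) (dSig a (dSk y)) ∧
        contractRoot RDSKS (dSig a b) = dSig a (dSk y) := by
  rcases contractRoot_cases RDSKS (dSig a b) with h | ⟨l, r, σ, h, ht, he⟩
  · exact Or.inl h
  · rcases h.redex_cases σ with ⟨⟨_, _, _, h₁⟩, -⟩ | ⟨h₁, h₂⟩
    · exact (dVer_ne_dSig _ _ _ _ _ (ht.trans h₁).symm).elim
    · obtain ⟨rfl, hb⟩ := (dSig_inj ..).1 (ht.trans h₁)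
      exact Or.inr ⟨σ 1, hb, he.trans h₂⟩

theorem contractRoot_dVer_cases :
    contractRoot RDSKS (dVer a b c) = dVer a b c ∨ contractRoot RDSKS (dVer a b c) = dOne := by
  rcases contractRoot_cases RDSKS (dVer a b c) with h | ⟨l, r, σ, h, ht, he⟩
  · exact Or.inl h
  · rcases h.redex_cases σ with ⟨-, h₂⟩ | ⟨h₁, -⟩
    · exact Or.inr (he.trans h₂)
    · exact (dVer_ne_dSig _ _ _ _ _ (ht.trans h₁)).elim

theorem contract_RDSKS_of_ADSKS (l r : TmD) (σ : Subst SgD arD) (h : ADSKS l r) :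
    contract RDSKS (subst σ l) = contract RDSKS (subst σ r) := by
  cases h <;>
    simp only [subst_dVer, subst_dSig, subst_dSk, subst_dSkp, subst_dPk, subst_dPkp, subst_dOne,
      contract_dVer, contract_dSig, contract_dSk, contract_dSkp, contract_dPk, contract_dPkp,
      contract_dOne, contractRoot_dSig_dSk, contractRoot_dSig_dSkp, xD, yD, y1D, y2D, subst]
  · simpa [subst_dVer, subst_dSig, subst_dSk, subst_dPk, subst_dOne, subst, xD, yD] using
      contractRoot_of_rule RDSKS.rootDeterministic (fun n => contract RDSKS (σ n)) RDSKS.r1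
  · rcases contractRoot_dSig_cases (contract RDSKS (σ 0))
        (dSkp (contract RDSKS (σ 1)) (contract RDSKS (σ 2))) with h | ⟨y, hb, h⟩
    · rw [h]
      simpa [subst_dVer, subst_dSig, subst_dSkp, subst_dPkp, subst_dOne, subst, xD, y1D, y2D]
        using contractRoot_of_rule RDSKS.rootDeterministic
          (fun n => contract RDSKS (σ n)) RDSKS.r2
    · obtain ⟨h₁, h₂⟩ := (dSkp_inj ..).1 hb
      rw [h, h₁, h₂]
      simpa [subst_dVer, subst_dSig, subst_dSk, subst_dPk, subst_dPkp, subst_dOne, subst, xD, yD]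
        using contractRoot_of_rule RDSKS.rootDeterministic
          (fun n => if n = 0 then contract RDSKS (σ 0) else y) RDSKS.r3

theorem dedStepSyn_of_dedStep_DSKS {E : Set TmD} {t : TmD} (hE : ∀ u ∈ E, NormalForm RDSKS u)
    (ht : NormalForm RDSKS t) (h : DedStep LDSKS' ADSKS E (E ∪ {t})) :
    DedStepSyn LDSKS' E (E ∪ {t}) := by
  obtain ⟨l, r, σ, hL, hl, hF⟩ := h.exists_contract contract_RDSKS_of_ADSKS hE ht
  rw [hF]
  have hL' := hL
  simp only [LDSKS', LDSKS, Set.mem_union, Set.mem_insert_iff, Set.mem_singleton_iff,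
    Prod.mk.injEq] at hL'
  have aux (h₁ : ∀ u ∈ l, contract RDSKS (subst σ u) = subst (fun n => contract RDSKS (σ n)) u)
      (h₂ : contract RDSKS (subst σ r) = subst (fun n => contract RDSKS (σ n)) r) :
      DedStepSyn LDSKS' E (E ∪ {contract RDSKS (subst σ r)}) :=
    ⟨l, r, _, hL, fun u hu => h₁ u hu ▸ hl u hu, by rw [h₂]⟩
  rcases hL' with (⟨rfl, rfl⟩ | ⟨rfl, rfl⟩ | ⟨rfl, rfl⟩ | ⟨rfl, rfl⟩ | ⟨rfl, rfl⟩ | ⟨rfl, rfl⟩) |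
    ⟨rfl, rfl⟩ | ⟨rfl, rfl⟩
  · rcases contractRoot_dSig_cases (contract RDSKS (σ 0)) (contract RDSKS (σ 1)) with
      h | ⟨y, hb, h⟩
    · apply aux <;> simp [subst_dSig, contract_dSig, subst, xD, yD, h]
    · refine ⟨{xD, dSkp (dPk yD) (dSig xD (dSk yD))}, dSig xD (dSk yD),
        (fun n => if n = 0 then contract RDSKS (σ 0) else y), by simp [LDSKS'], ?_, ?_⟩
      · have h₀ := hl xD (by simp)
        have h₁ := hl yD (by simp)
        simp only [subst, xD, yD, hb] at h₀ h₁
        simp [subst_dSig, subst_dSkp, subst_dPk, subst_dSk, subst, xD, yD, h₀, h₁]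
      · simp [subst_dSig, subst_dSk, contract_dSig, subst, xD, yD, h]
  · rcases contractRoot_dVer_cases (contract RDSKS (σ 0)) (contract RDSKS (σ 1))
      (contract RDSKS (σ 2)) with h | h
    · apply aux <;> simp [subst_dVer, contract_dVer, subst, xD, yD, zD, h]
    · exact ⟨∅, dOne, σ, by simp [LDSKS', LDSKS], by simp,
        by simp [subst_dVer, subst_dOne, contract_dVer, subst, xD, yD, zD, h]⟩
  all_goals
    apply aux <;>
      simp [subst_dSig, subst_dSkp, subst_dPkp, subst_dPk, subst_dSk, subst_dZero, subst_dOne,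
        contract_dSig, contract_dSkp, contract_dPkp, contract_dPk, contract_dSk, contract_dZero,
        contract_dOne, contractRoot_dSig_dSk, subst, xD, yD]

end DSKS

section DEO

variable (σ : Subst SgE arE) (a b c a' b' c' : TmE)

theorem subst_eSig : subst σ (eSig a b) = eSig (subst σ a) (subst σ b) := by
  simp only [eSig, subst]; congr 1; funext i; fin_cases i <;> rfl
theorem subst_eVer : subst σ (eVer a b c) = eVer (subst σ a) (subst σ b) (subst σ c) := by
  simp only [eVer, subst]; congr 1; funext i; fin_cases i <;> rfl
theorem subst_eSkp : subst σ (eSkp a b) = eSkp (subst σ a) (subst σ b) := by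
  simp only [eSkp, subst]; congr 1; funext i; fin_cases i <;> rfl
theorem subst_ePkp : subst σ (ePkp a b) = ePkp (subst σ a) (subst σ b) := by
  simp only [ePkp, subst]; congr 1; funext i; fin_cases i <;> rfl
theorem subst_eF : subst σ (eF a b) = eF (subst σ a) (subst σ b) := by
  simp only [eF, subst]; congr 1; funext i; fin_cases i <;> rfl
theorem subst_eSk : subst σ (eSk a) = eSk (subst σ a) := by
  simp only [eSk, subst]; congr 1; funext i; fin_cases i; rfl
theorem subst_ePk : subst σ (ePk a) = ePk (subst σ a) := by
  simp only [ePk, subst]; congr 1; funext i; fin_cases i; rfl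
theorem subst_eZero : subst σ eZero = eZero := by
  simp only [eZero, subst]; congr 1; funext i; exact i.elim0
theorem subst_eOne : subst σ eOne = eOne := by
  simp only [eOne, subst]; congr 1; funext i; exact i.elim0

theorem eSig_inj : eSig a b = eSig a' b' ↔ a = a' ∧ b = b' :=
  ⟨fun h => ⟨congrFun (Tm.app_injective h) (0 : Fin 2),
    congrFun (Tm.app_injective h) (1 : Fin 2)⟩,
    by rintro ⟨rfl, rfl⟩; rfl⟩
theorem eVer_inj : eVer a b c = eVer a' b' c' ↔ a = a' ∧ b = b' ∧ c = c' :=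
  ⟨fun h => ⟨congrFun (Tm.app_injective h) (0 : Fin 3),
    congrFun (Tm.app_injective h) (1 : Fin 3),
    congrFun (Tm.app_injective h) (2 : Fin 3)⟩,
    by rintro ⟨rfl, rfl, rfl⟩; rfl⟩
theorem eSkp_inj : eSkp a b = eSkp a' b' ↔ a = a' ∧ b = b' :=
  ⟨fun h => ⟨congrFun (Tm.app_injective h) (0 : Fin 2),
    congrFun (Tm.app_injective h) (1 : Fin 2)⟩,
    by rintro ⟨rfl, rfl⟩; rfl⟩
theorem eF_inj : eF a b = eF a' b' ↔ a = a' ∧ b = b' :=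
  ⟨fun h => ⟨congrFun (Tm.app_injective h) (0 : Fin 2),
    congrFun (Tm.app_injective h) (1 : Fin 2)⟩,
    by rintro ⟨rfl, rfl⟩; rfl⟩
theorem ePk_inj : ePk a = ePk a' ↔ a = a' :=
  ⟨fun h => congrFun (Tm.app_injective h) (0 : Fin 1),
    by rintro rfl; rfl⟩

theorem eSk_ne_eSkp : eSk a ≠ eSkp a' b' :=
  Tm.app_ne_app (by simp) _ _
theorem eVer_ne_eSig : eVer a b c ≠ eSig a' b' :=
  Tm.app_ne_app (by simp) _ _

/-- Shape of the redexes of `RDEO`. -/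
theorem RDEO.redex_cases {l r : TmE} (h : RDEO l r) :
    ((∃ a b c, subst σ l = eVer a b c) ∧ subst σ r = eOne) ∨
      subst σ l = eSig (eF (ePk (σ 1)) (eSig (σ 0) (eSk (σ 1))))
          (eSkp (ePk (σ 1)) (eSig (σ 0) (eSk (σ 1)))) ∧
        subst σ r = eSig (σ 0) (eSk (σ 1)) := by
  cases h <;>
    simp [subst_eVer, subst_eSig, subst_eSk, subst_eSkp, subst_eF, subst_ePk, subst_ePkp,
      subst_eOne,
      eVer_inj, xE, yE, subst]

theorem RDEO.rootDeterministic : RootDeterministic RDEO := by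
  intro l r l' r' σ σ' h h' he
  rcases h.redex_cases σ with ⟨⟨a, b, c, h₁⟩, h₂⟩ | ⟨h₁, h₂⟩ <;>
    rcases h'.redex_cases σ' with ⟨⟨a', b', c', h₁'⟩, h₂'⟩ | ⟨h₁', h₂'⟩ <;>
    rw [h₁, h₁'] at he <;> rw [h₂, h₂']
  · exact (eVer_ne_eSig _ _ _ _ _ he).elim
  · exact (eVer_ne_eSig _ _ _ _ _ he.symm).elim
  · simp only [eSig_inj, eF_inj, ePk_inj] at he
    rw [he.1.1, he.1.2.1]

theorem contractRoot_RDEO_eq_self {t : TmE} (hv : ∀ a b c, t ≠ eVer a b c)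
    (hs : ∀ a b, t ≠ eSig (eF (ePk b) (eSig a (eSk b))) (eSkp (ePk b) (eSig a (eSk b)))) :
    contractRoot RDEO t = t := by
  rcases contractRoot_cases RDEO t with h | ⟨l, r, σ, h, ht, -⟩
  · exact h
  · rcases h.redex_cases σ with ⟨⟨a, b, c, h₁⟩, -⟩ | ⟨h₁, -⟩
    · exact absurd (ht.trans h₁) (hv _ _ _)
    · exact absurd (ht.trans h₁) (hs _ _)

theorem contract_eVer : contract RDEO (eVer a b c) =
    contractRoot RDEO (eVer (contract RDEO a) (contract RDEO b) (contract RDEO c)) := by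
  simp only [eVer, contract]; congr 2; funext i; fin_cases i <;> rfl
theorem contract_eSig : contract RDEO (eSig a b) =
    contractRoot RDEO (eSig (contract RDEO a) (contract RDEO b)) := by
  simp only [eSig, contract]; congr 2; funext i; fin_cases i <;> rfl
theorem contract_eSkp :
    contract RDEO (eSkp a b) = eSkp (contract RDEO a) (contract RDEO b) := by
  refine Eq.trans ?_ (contractRoot_RDEO_eq_self (t := eSkp (contract RDEO a) _) ?_ ?_)
  · simp only [eSkp, contract]; congr 2; funext i; fin_cases i <;> rfl
  all_goals intros; exact Tm.app_ne_app (by simp) _ _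
theorem contract_ePkp :
    contract RDEO (ePkp a b) = ePkp (contract RDEO a) (contract RDEO b) := by
  refine Eq.trans ?_ (contractRoot_RDEO_eq_self (t := ePkp (contract RDEO a) _) ?_ ?_)
  · simp only [ePkp, contract]; congr 2; funext i; fin_cases i <;> rfl
  all_goals intros; exact Tm.app_ne_app (by simp) _ _
theorem contract_eF :
    contract RDEO (eF a b) = eF (contract RDEO a) (contract RDEO b) := by
  refine Eq.trans ?_ (contractRoot_RDEO_eq_self (t := eF (contract RDEO a) _) ?_ ?_)
  · simp only [eF, contract]; congr 2; funext i; fin_cases i <;> rfl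
  all_goals intros; exact Tm.app_ne_app (by simp) _ _
theorem contract_eSk : contract RDEO (eSk a) = eSk (contract RDEO a) := by
  refine Eq.trans ?_ (contractRoot_RDEO_eq_self (t := eSk (contract RDEO a)) ?_ ?_)
  · simp only [eSk, contract]; congr 2; funext i; fin_cases i; rfl
  all_goals intros; exact Tm.app_ne_app (by simp) _ _
theorem contract_ePk : contract RDEO (ePk a) = ePk (contract RDEO a) := by
  refine Eq.trans ?_ (contractRoot_RDEO_eq_self (t := ePk (contract RDEO a)) ?_ ?_)
  · simp only [ePk, contract]; congr 2; funext i; fin_cases i; rfl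
  all_goals intros; exact Tm.app_ne_app (by simp) _ _
theorem contract_eZero : contract RDEO eZero = eZero := by
  refine Eq.trans ?_ (contractRoot_RDEO_eq_self (t := eZero) ?_ ?_)
  · simp only [eZero, contract]; congr 2; funext i; exact i.elim0
  all_goals intros; exact Tm.app_ne_app (by simp) _ _
theorem contract_eOne : contract RDEO eOne = eOne := by
  refine Eq.trans ?_ (contractRoot_RDEO_eq_self (t := eOne) ?_ ?_)
  · simp only [eOne, contract]; congr 2; funext i; exact i.elim0
  all_goals intros; exact Tm.app_ne_app (by simp) _ _

theorem contractRoot_eSig_eSk :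
    contractRoot RDEO (eSig a (eSk b)) = eSig a (eSk b) := by
  apply contractRoot_RDEO_eq_self
  · intros; exact Tm.app_ne_app (by simp) _ _
  · intro a' b' h
    exact eSk_ne_eSkp _ _ _ ((eSig_inj ..).1 h).2

theorem contractRoot_eSig_eF_eSkp :
    contractRoot RDEO (eSig (eF (ePk b) (eSig a (eSk b))) (eSkp (ePk b) (eSig a (eSk b)))) =
      eSig a (eSk b) := by
  simpa [subst_eSig, subst_eSkp, subst_eF, subst_ePk, subst_eSk, subst, xE, yE] using
    contractRoot_of_rule RDEO.rootDeterministic (fun n => if n = 0 then a else b) RDEO.r4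

theorem contractRoot_eSig_cases :
    contractRoot RDEO (eSig a b) = eSig a b ∨
      ∃ x y, a = eF (ePk y) (eSig x (eSk y)) ∧ b = eSkp (ePk y) (eSig x (eSk y)) ∧
        contractRoot RDEO (eSig a b) = eSig x (eSk y) := by
  rcases contractRoot_cases RDEO (eSig a b) with h | ⟨l, r, σ, h, ht, he⟩
  · exact Or.inl h
  · rcases h.redex_cases σ with ⟨⟨_, _, _, h₁⟩, -⟩ | ⟨h₁, h₂⟩
    · exact (eVer_ne_eSig _ _ _ _ _ (ht.trans h₁).symm).elim
    · obtain ⟨ha, hb⟩ := (eSig_inj ..).1 (ht.trans h₁)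
      exact Or.inr ⟨σ 0, σ 1, ha, hb, he.trans h₂⟩

theorem contractRoot_eVer_cases :
    contractRoot RDEO (eVer a b c) = eVer a b c ∨ contractRoot RDEO (eVer a b c) = eOne := by
  rcases contractRoot_cases RDEO (eVer a b c) with h | ⟨l, r, σ, h, ht, he⟩
  · exact Or.inl h
  · rcases h.redex_cases σ with ⟨-, h₂⟩ | ⟨h₁, -⟩
    · exact Or.inr (he.trans h₂)
    · exact (eVer_ne_eSig _ _ _ _ _ (ht.trans h₁)).elim

theorem contract_RDEO_of_ADEO (l r : TmE) (σ : Subst SgE arE) (h : ADEO l r) :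
    contract RDEO (subst σ l) = contract RDEO (subst σ r) := by
  cases h <;>
    simp only [subst_eVer, subst_eSig, subst_eSk, subst_eSkp, subst_eF, subst_ePk, subst_ePkp,
      subst_eOne,
      contract_eVer, contract_eSig, contract_eSk, contract_eSkp, contract_eF, contract_ePk,
      contract_ePkp,
      contract_eOne, contractRoot_eSig_eSk, contractRoot_eSig_eF_eSkp, xE, yE, y1E, y2E, subst]
  · simpa [subst_eVer, subst_eSig, subst_eSk, subst_ePk, subst_eOne, subst, xE, yE] using
      contractRoot_of_rule RDEO.rootDeterministic (fun n => contract RDEO (σ n)) RDEO.r1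
  · rcases contractRoot_eSig_cases (contract RDEO (σ 0))
        (eSkp (contract RDEO (σ 1)) (contract RDEO (σ 2))) with h | ⟨x, y, ha, hb, h⟩
    · rw [h]
      simpa [subst_eVer, subst_eSig, subst_eSkp, subst_eF, subst_ePkp, subst_eOne, subst, xE, y1E,
        y2E]
        using contractRoot_of_rule RDEO.rootDeterministic
          (fun n => contract RDEO (σ n)) RDEO.r2
    · obtain ⟨h₁, h₂⟩ := (eSkp_inj ..).1 hb
      rw [h, ha, h₁, h₂]
      simpa [subst_eVer, subst_eSig, subst_eSk, subst_ePk, subst_ePkp, subst_eF, subst_eOne,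
        subst, xE, yE] using contractRoot_of_rule RDEO.rootDeterministic
          (fun n => if n = 0 then x else y) RDEO.r3

theorem dedStepSyn_of_dedStep_DEO {E : Set TmE} {t : TmE} (hE : ∀ u ∈ E, NormalForm RDEO u)
    (ht : NormalForm RDEO t) (h : DedStep LDEO' ADEO E (E ∪ {t})) :
    DedStepSyn LDEO' E (E ∪ {t}) := by
  obtain ⟨l, r, σ, hL, hl, hF⟩ := h.exists_contract contract_RDEO_of_ADEO hE ht
  rw [hF]
  have hL' := hL
  simp only [LDEO', LDEO, Set.mem_union, Set.mem_insert_iff, Set.mem_singleton_iff,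
    Prod.mk.injEq] at hL'
  have aux (h₁ : ∀ u ∈ l, contract RDEO (subst σ u) = subst (fun n => contract RDEO (σ n)) u)
      (h₂ : contract RDEO (subst σ r) = subst (fun n => contract RDEO (σ n)) r) :
      DedStepSyn LDEO' E (E ∪ {contract RDEO (subst σ r)}) :=
    ⟨l, r, _, hL, fun u hu => h₁ u hu ▸ hl u hu, by rw [h₂]⟩
  rcases hL' with (⟨rfl, rfl⟩ | ⟨rfl, rfl⟩ | ⟨rfl, rfl⟩ | ⟨rfl, rfl⟩ | ⟨rfl, rfl⟩ | ⟨rfl, rfl⟩ |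
    ⟨rfl, rfl⟩) | ⟨rfl, rfl⟩
  · rcases contractRoot_eSig_cases (contract RDEO (σ 0)) (contract RDEO (σ 1)) with
      h | ⟨x, y, ha, hb, h⟩
    · apply aux <;> simp [subst_eSig, contract_eSig, subst, xE, yE, h]
    · refine ⟨{eF (ePk yE) (eSig xE (eSk yE)), eSkp (ePk yE) (eSig xE (eSk yE))}, eSig xE (eSk yE),
        (fun n => if n = 0 then x else y), by simp [LDEO'], ?_, ?_⟩
      · have h₀ := hl xE (by simp)
        have h₁ := hl yE (by simp)
        simp only [subst, xE, yE, ha, hb] at h₀ h₁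
        simp [subst_eSig, subst_eSkp, subst_eF, subst_ePk, subst_eSk, subst, xE, yE, h₀, h₁]
      · simp [subst_eSig, subst_eSk, contract_eSig, subst, xE, yE, h]
  · rcases contractRoot_eVer_cases (contract RDEO (σ 0)) (contract RDEO (σ 1))
      (contract RDEO (σ 2)) with h | h
    · apply aux <;> simp [subst_eVer, contract_eVer, subst, xE, yE, zE, h]
    · exact ⟨∅, eOne, σ, by simp [LDEO', LDEO], by simp,
        by simp [subst_eVer, subst_eOne, contract_eVer, subst, xE, yE, zE, h]⟩
  all_goals
    apply aux <;>
      simp [subst_eSig, subst_eSkp, subst_eF, subst_ePkp, subst_ePk, subst_eSk, subst_eZero,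
        subst_eOne,
        contract_eSig, contract_eSkp, contract_eF, contract_ePkp, contract_ePk, contract_eSk,
        contract_eZero,
        contract_eOne, contractRoot_eSig_eSk, subst, xE, yE]

end DEO

/-- for any finite set `E` of ground terms in normal form and any
ground term `t` in normal form, `E ↠_{I'} E, t` (one deduction step modulo the
equational theory) iff `E ↠_{I_∅} E, t` (one deduction step modulo the empty
theory), for the saturated systems I'_DSKS and I'_DEO. -/
theorem one_step_modulo_iff_one_step_syntactic :
    (∀ (E : Set TmD) (t : TmD), E.Finite →
       (∀ u ∈ E, Ground u ∧ NormalForm RDSKS u) →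
       Ground t → NormalForm RDSKS t →
       (DedStep LDSKS' ADSKS E (E ∪ {t}) ↔ DedStepSyn LDSKS' E (E ∪ {t}))) ∧
    (∀ (E : Set TmE) (t : TmE), E.Finite →
       (∀ u ∈ E, Ground u ∧ NormalForm RDEO u) →
       Ground t → NormalForm RDEO t →
       (DedStep LDEO' ADEO E (E ∪ {t}) ↔ DedStepSyn LDEO' E (E ∪ {t}))) := by
  refine ⟨fun E t _ hE _ ht => ⟨?_, DedStepSyn.dedStep _⟩,
    fun E t _ hE _ ht => ⟨?_, DedStepSyn.dedStep _⟩⟩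
  · exact dedStepSyn_of_dedStep_DSKS (fun u hu => (hE u hu).2) ht
  · exact dedStepSyn_of_dedStep_DEO (fun u hu => (hE u hu).2) ht

end Paper
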